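/- Let m be a nonnegative integer and let γ₊ > 0 and γ₋ > 0 be real numbers. Then for all real numbers τ₁ ≥ 0 and τ₂ ≥ 0 there exists a unique t ≥ 0 such that (1 + τ₁)^m · τ₂ · (2(γ₊ + γ₋) − t) = t · (2γ₋ + m·t)^m. -/

import Mathlib

/-- For a nonnegative integer `m` and reals `γ₊, γ₋ > 0`, for all reals
`τ₁, τ₂ ≥ 0` there is a unique `t ≥ 0` with
`(1 + τ₁)^m · τ₂ · (2(γ₊ + γ₋) − t) = t · (2γ₋ + m·t)^m`. -/
theorem stmt19
    (m : ℕ) (γp γm : ℝ) (hγp : 0 < γp) (hγm : 0 < γm) :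
    ∀ τ₁ τ₂ : ℝ, 0 ≤ τ₁ → 0 ≤ τ₂ →
      ∃! t : ℝ, 0 ≤ t ∧
        (1 + τ₁) ^ m * τ₂ * (2 * (γp + γm) - t) = t * (2 * γm + (m : ℝ) * t) ^ m := by
  intro τ₁ τ₂ hτ₁ hτ₂
  have hC : 0 ≤ (1 + τ₁) ^ m * τ₂ := by positivity
  generalize (1 + τ₁) ^ m * τ₂ = C at hC ⊢
  have hlt : ∀ s t : ℝ, 0 ≤ s → s < t →
      s * (2 * γm + (m : ℝ) * s) ^ m - C * (2 * (γp + γm) - s) <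
        t * (2 * γm + (m : ℝ) * t) ^ m - C * (2 * (γp + γm) - t) := by
    intro s t hs hst
    have hpow : (2 * γm + (m : ℝ) * s) ^ m ≤ (2 * γm + (m : ℝ) * t) ^ m := by gcongr
    have hpos : 0 < (2 * γm + (m : ℝ) * s) ^ m := by positivity
    have hmul : s * (2 * γm + (m : ℝ) * s) ^ m < t * (2 * γm + (m : ℝ) * t) ^ m :=
      mul_lt_mul hst hpow hpos (hs.trans hst.le)
    have hlin : C * (2 * (γp + γm) - t) ≤ C * (2 * (γp + γm) - s) := by gcongr
    linarith
  have hS : 0 ≤ 2 * (γp + γm) := by positivity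
  obtain ⟨t, ht, hft⟩ : ∃ t ∈ Set.Icc 0 (2 * (γp + γm)),
      t * (2 * γm + (m : ℝ) * t) ^ m - C * (2 * (γp + γm) - t) = 0 := by
    refine intermediate_value_Icc hS (f := fun t : ℝ ↦
      t * (2 * γm + (m : ℝ) * t) ^ m - C * (2 * (γp + γm) - t)) (by fun_prop) ⟨?_, ?_⟩
    · simpa using mul_nonneg hC hS
    · simp only [sub_self, mul_zero, sub_zero]
      positivity
  refine ⟨t, ⟨ht.1, by linarith⟩, ?_⟩
  rintro s ⟨hs, hfs⟩
  rcases lt_trichotomy s t with h | h | h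
  · linarith [hlt s t hs h]
  · exact h
  · linarith [hlt t s ht.1 h]
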